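/- Let C be a comparator network on n channels and let D be the comparator network on n−1 channels obtained from C by removing the first channel and all comparators attached to it. Then for every Boolean input x ∈ {0,1}^{n−1}, C(0x) = 0·D(x), where 0x denotes prefixing x with a 0. Consequently, if C sorts every input of the form 0x, then D is a sorting network on n−1 channels. -/

import Mathlib

/-- A comparator on `n` channels: an ordered pair of channel indices
(the first component receives the minimum, the second the maximum). -/
abbrev Comparator (n : ℕ) : Type := Fin n × Fin n

/-- A layer of a comparator network: a list of comparators. -/
abbrev Layer (n : ℕ) : Type := List (Comparator n)

/-- A comparator network: a list of layers; its depth is the length of this list. -/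
abbrev Network (n : ℕ) : Type := List (Layer n)

/-- Two comparators are channel-disjoint if they share no channel. -/
def ChDisjoint {n : ℕ} (c d : Comparator n) : Prop :=
  c.1 ≠ d.1 ∧ c.1 ≠ d.2 ∧ c.2 ≠ d.1 ∧ c.2 ≠ d.2

/-- A valid (ordinary) layer: every comparator `⟨i,j⟩` satisfies `i < j`
and every channel occurs at most once in the layer. -/
def IsLayer {n : ℕ} (L : Layer n) : Prop :=
  (∀ c ∈ L, c.1 < c.2) ∧ L.Pairwise ChDisjoint

/-- A valid (ordinary) comparator network: all its layers are valid layers. -/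
def IsNetwork {n : ℕ} (C : Network n) : Prop := ∀ L ∈ C, IsLayer L

/-- Applying the comparator `c = ⟨i,j⟩` to a vector of values:
channel `i` receives the minimum and channel `j` the maximum of the
values on channels `i` and `j`; all other channels are unchanged. -/
def applyComparator {n : ℕ} {α : Type*} [LinearOrder α] (c : Comparator n)
    (v : Fin n → α) : Fin n → α := fun k =>
  if k = c.1 then min (v c.1) (v c.2)
  else if k = c.2 then max (v c.1) (v c.2)
  else v k

/-- Applying a layer: apply all its comparators (they act on disjoint channels). -/
def applyLayer {n : ℕ} {α : Type*} [LinearOrder α] (L : Layer n)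
    (v : Fin n → α) : Fin n → α :=
  L.foldl (fun w c => applyComparator c w) v

/-- Applying a network: apply its layers in sequence; `applyNetwork C x` is `C(x)`. -/
def applyNetwork {n : ℕ} {α : Type*} [LinearOrder α] (C : Network n)
    (v : Fin n → α) : Fin n → α :=
  C.foldl (fun w L => applyLayer L w) v

/-- `C` sorts every Boolean input: `C(x)` is sorted ascendingly for all `x ∈ {0,1}ⁿ`. -/
def Sorts {n : ℕ} (C : Network n) : Prop :=
  ∀ x : Fin n → Bool, Monotone (applyNetwork C x)

/-- A sorting network: a valid comparator network sorting every Boolean input. -/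
def IsSortingNetwork {n : ℕ} (C : Network n) : Prop := IsNetwork C ∧ Sorts C

/-- The network obtained from `C` by removing the first channel and all
comparators attached to it. -/
def removeFirstChannel {n : ℕ} (C : Network (n + 1)) : Network n :=
  C.map (fun L => L.filterMap (fun c =>
    if h : 0 < c.1.val ∧ 0 < c.2.val then
      some (⟨c.1.val - 1, by have := c.1.isLt; omega⟩,
            ⟨c.2.val - 1, by have := c.2.isLt; omega⟩)
    else none))

/-- The comparator on the channels other than the first one corresponding to `c`,
if `c` is not attached to the first channel. -/
def lowerComparator {n : ℕ} (c : Comparator (n + 1)) : Option (Comparator n) :=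
  if h : 0 < c.1.val ∧ 0 < c.2.val then
    some (⟨c.1.val - 1, by have := c.1.isLt; omega⟩,
          ⟨c.2.val - 1, by have := c.2.isLt; omega⟩)
  else none

theorem removeFirstChannel_eq_map {n : ℕ} (C : Network (n + 1)) :
    removeFirstChannel C = C.map (List.filterMap lowerComparator) := rfl

theorem eq_succ_of_lowerComparator_eq_some {n : ℕ} {c : Comparator (n + 1)} {d : Comparator n}
    (h : lowerComparator c = some d) : c = (d.1.succ, d.2.succ) := by
  unfold lowerComparator at h
  split_ifs at h with hc
  obtain rfl := Option.some.inj h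
  ext <;> simp <;> omega

theorem fst_eq_zero_of_lowerComparator_eq_none {n : ℕ} {c : Comparator (n + 1)}
    (hc : c.1 < c.2) (h : lowerComparator c = none) : c.1 = 0 := by
  unfold lowerComparator at h
  split_ifs at h with h'
  ext
  simp only [Fin.lt_def] at hc
  simp only [Fin.val_zero]
  omega

section Apply

variable {n : ℕ} {α : Type*} [LinearOrder α]

theorem applyComparator_succ_cons (d : Comparator n) (a : α) (v : Fin n → α) :
    applyComparator (d.1.succ, d.2.succ) (Fin.cons a v : Fin (n + 1) → α) =
      Fin.cons a (applyComparator d v) := by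
  funext k
  refine Fin.cases ?_ (fun k => ?_) k
  · simp [applyComparator, (Fin.succ_ne_zero _).symm]
  · simp [applyComparator]

theorem applyComparator_eq_self {c : Comparator n} {v : Fin n → α} (h : v c.1 ≤ v c.2) :
    applyComparator c v = v := by
  funext k
  unfold applyComparator
  split_ifs with h₁ h₂
  · rw [h₁, min_eq_left h]
  · rw [h₂, max_eq_right h]
  · rfl

theorem applyLayer_cons_bot [OrderBot α] (L : Layer (n + 1)) (hL : ∀ c ∈ L, c.1 < c.2)
    (v : Fin n → α) :
    applyLayer L (Fin.cons ⊥ v : Fin (n + 1) → α) =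
      Fin.cons ⊥ (applyLayer (L.filterMap lowerComparator) v) := by
  induction L generalizing v with
  | nil => rfl
  | cons c L ih =>
    rw [List.forall_mem_cons] at hL
    have ih := ih hL.2
    simp only [applyLayer, List.foldl_cons] at ih ⊢
    cases h : lowerComparator c with
    | none =>
      have h_fst := fst_eq_zero_of_lowerComparator_eq_none hL.1 h
      rw [List.filterMap_cons_none h, applyComparator_eq_self (by simp [h_fst]), ih]
    | some d =>
      rw [List.filterMap_cons_some h, eq_succ_of_lowerComparator_eq_some h,
        applyComparator_succ_cons, ih, List.foldl_cons]

theorem applyNetwork_cons_bot [OrderBot α] (C : Network (n + 1)) (hC : IsNetwork C)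
    (v : Fin n → α) :
    applyNetwork C (Fin.cons ⊥ v : Fin (n + 1) → α) =
      Fin.cons ⊥ (applyNetwork (removeFirstChannel C) v) := by
  rw [removeFirstChannel_eq_map]
  induction C generalizing v with
  | nil => rfl
  | cons L C ih =>
    obtain ⟨hL, hC⟩ := List.forall_mem_cons.1 hC
    have ih := ih hC
    simp only [applyNetwork, List.map_cons, List.foldl_cons] at ih ⊢
    rw [applyLayer_cons_bot L hL.1, ih]

end Apply

theorem IsLayer.filterMap_lowerComparator {n : ℕ} {L : Layer (n + 1)} (hL : IsLayer L) :
    IsLayer (L.filterMap lowerComparator) := by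
  refine ⟨fun d hd => ?_, hL.2.filterMap _ fun c c' hcc' d hd d' hd' => ?_⟩
  · obtain ⟨c, hc, hcd⟩ := List.mem_filterMap.1 hd
    have hlt := hL.1 c hc
    rw [eq_succ_of_lowerComparator_eq_some hcd] at hlt
    exact Fin.succ_lt_succ_iff.1 hlt
  · rw [eq_succ_of_lowerComparator_eq_some hd, eq_succ_of_lowerComparator_eq_some hd'] at hcc'
    simpa [ChDisjoint] using hcc'

theorem IsNetwork.removeFirstChannel {n : ℕ} {C : Network (n + 1)} (hC : IsNetwork C) :
    IsNetwork (removeFirstChannel C) := by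
  rw [removeFirstChannel_eq_map]
  exact List.forall_mem_map.2 fun L hL => (hC L hL).filterMap_lowerComparator

/-- if `D` is obtained from `C` by removing the first channel
and all comparators attached to it, then `C(0x) = 0·D(x)` for every Boolean `x`;
consequently, if `C` sorts every input of the form `0x` then `D` is a sorting
network on `n − 1` channels. -/
theorem statement_12 {n : ℕ} (C : Network (n + 1)) (hC : IsNetwork C) :
    (∀ x : Fin n → Bool,
      applyNetwork C (Fin.cons false x) =
        Fin.cons false (applyNetwork (removeFirstChannel C) x)) ∧
    ((∀ x : Fin n → Bool, Monotone (applyNetwork C (Fin.cons false x))) →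
      IsSortingNetwork (removeFirstChannel C)) := by
  have h_apply : ∀ x : Fin n → Bool, applyNetwork C (Fin.cons false x) =
      Fin.cons false (applyNetwork (removeFirstChannel C) x) :=
    applyNetwork_cons_bot C hC
  refine ⟨h_apply, fun h => ⟨hC.removeFirstChannel, fun x i j hij => ?_⟩⟩
  have h_le := h x (Fin.succ_le_succ_iff.2 hij)
  rwa [h_apply, Fin.cons_succ, Fin.cons_succ] at h_le
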